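/- Let p ≥ 2. For any real numbers q_0, …, q_{p−3} there exists a unique real polynomial h of degree at most p+1 with Legendre expansion h = Σ_{i=0}^{p+1} h̃_i P_i such that: h̃_i = q_i for all 0 ≤ i ≤ p−3; the sum of h̃_i over all even indices i with 0 ≤ i ≤ p−1 equals 0; the sum of h̃_i over all odd indices i with 0 ≤ i ≤ p−1 equals 0; h(−1) = 1; and h(1) = 0. Hence these conditions determine a (p−2)-parameter family of left correction functions. -/

import Mathlib

open Polynomial Finset

/-- The degree-`n` Legendre polynomial of the first kind on `[-1,1]`, defined by the
Rodrigues formula `P_n(x) = 1/(2^n n!) · dⁿ/dxⁿ (x² − 1)ⁿ`. -/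
noncomputable def legendre (n : ℕ) : Polynomial ℝ :=
  Polynomial.C ((1 : ℝ) / (2 ^ n * n.factorial)) *
    (Polynomial.derivative^[n] ((Polynomial.X ^ 2 - 1) ^ n))

theorem eval_legendre_of_factor (n : ℕ) (a b : ℝ)
    (h : (X ^ 2 - 1 : ℝ[X]) = (X - C a) * (X - C b)) :
    (legendre n).eval a = ((a - b) / 2) ^ n := by
  have key := aeval_iterate_derivative_self ((X ^ 2 - 1 : ℝ[X]) ^ n) n a
    (p' := (X - C b) ^ n) (by rw [Algebra.algebraMap_self, Polynomial.map_id, h, mul_pow])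
  rw [coe_aeval_eq_eval] at key
  have hn : (n.factorial : ℝ) ≠ 0 := by positivity
  rw [legendre, eval_mul, eval_C, key]
  simp only [eval_pow, eval_sub, eval_X, eval_C, nsmul_eq_mul, div_pow]
  field_simp

theorem eval_one_legendre (n : ℕ) : (legendre n).eval 1 = 1 := by
  rw [eval_legendre_of_factor n 1 (-1) (by simp; ring)]
  norm_num

theorem eval_neg_one_legendre (n : ℕ) : (legendre n).eval (-1) = (-1) ^ n := by
  rw [eval_legendre_of_factor n (-1) 1 (by simp; ring)]
  norm_num

theorem sum_eq_sum_even_add_sum_odd (s : Finset ℕ) (f : ℕ → ℝ) :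
    ∑ i ∈ s, f i = ∑ i ∈ s with Even i, f i + ∑ i ∈ s with Odd i, f i := by
  simp only [← Nat.not_even_iff_odd, sum_filter_add_sum_filter_not]

theorem sum_neg_one_pow_mul_eq_sum_even_sub_sum_odd (s : Finset ℕ) (f : ℕ → ℝ) :
    ∑ i ∈ s, f i * (-1) ^ i = ∑ i ∈ s with Even i, f i - ∑ i ∈ s with Odd i, f i := by
  rw [sum_eq_sum_even_add_sum_odd, sub_eq_add_neg, ← sum_neg_distrib]
  congr 1 <;> refine sum_congr rfl fun i hi => ?_
  · simp [(mem_filter.1 hi).2.neg_one_pow]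
  · simp [(mem_filter.1 hi).2.neg_one_pow]

/-- When the even and odd partial sums of the coefficients below `p` vanish, the endpoint
conditions determine exactly the last two Legendre coefficients. -/
theorem endpoint_conditions_iff (p : ℕ) (f : ℕ → ℝ)
    (he : ∑ i ∈ range p with Even i, f i = 0) (ho : ∑ i ∈ range p with Odd i, f i = 0) :
    ((∑ i ∈ range (p + 2), C (f i) * legendre i).eval (-1) = 1 ∧
      (∑ i ∈ range (p + 2), C (f i) * legendre i).eval 1 = 0) ↔
    f p = (-1) ^ p / 2 ∧ f (p + 1) = -((-1) ^ p / 2) := by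
  have h1 := sum_eq_sum_even_add_sum_odd (range p) f
  have h2 := sum_neg_one_pow_mul_eq_sum_even_sub_sum_odd (range p) f
  simp only [eval_add, eval_finsetSum, eval_mul, eval_C, eval_one_legendre,
    eval_neg_one_legendre, mul_one, sum_range_succ, h1, h2, he, ho, pow_succ]
  rcases neg_one_pow_eq_or ℝ p with h | h <;> rw [h] <;> constructor <;> rintro ⟨ha, hb⟩ <;>
    constructor <;> linarith

/-- The parity conditions determine the two coefficients following the prescribed ones. -/
theorem parity_conditions_iff (m : ℕ) (f : ℕ → ℝ) :
    ((∑ i ∈ range (m + 2) with Even i, f i = 0) ∧ ∑ i ∈ range (m + 2) with Odd i, f i = 0) ↔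
    f m = -(∑ i ∈ range m with (Even i ↔ Even m), f i) ∧
      f (m + 1) = -(∑ i ∈ range m with ¬(Even i ↔ Even m), f i) := by
  simp only [sum_filter, sum_range_succ, ← Nat.not_even_iff_odd, Nat.even_add_one]
  by_cases h : Even m <;> simp only [h, not_true, not_false_iff, iff_true, iff_false, if_true,
    if_false, not_not, add_zero] <;> constructor <;> rintro ⟨ha, hb⟩ <;> constructor <;> linarith

theorem glsfr_left_correction_parameterisation (p : ℕ) (hp : 2 ≤ p) (q : ℕ → ℝ) :
    ∃! h : Polynomial ℝ, ∃ ht : ℕ → ℝ,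
      h = ∑ i ∈ Finset.range (p + 2), Polynomial.C (ht i) * legendre i ∧
      (∀ i : ℕ, i + 3 ≤ p → ht i = q i) ∧
      (∑ i ∈ (Finset.range p).filter (fun i => Even i), ht i) = 0 ∧
      (∑ i ∈ (Finset.range p).filter (fun i => Odd i), ht i) = 0 ∧
      h.eval (-1 : ℝ) = 1 ∧ h.eval (1 : ℝ) = 0 := by
  obtain ⟨m, rfl⟩ := Nat.exists_eq_add_of_le' hp
  let c : ℕ → ℝ := fun i =>
    if i < m then q i
    else if i = m then -(∑ j ∈ range m with (Even j ↔ Even m), q j)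
    else if i = m + 1 then -(∑ j ∈ range m with ¬(Even j ↔ Even m), q j)
    else if i = m + 2 then (-1) ^ (m + 2) / 2
    else -((-1) ^ (m + 2) / 2)
  have sum_congr_lt (f : ℕ → ℝ) (hf : ∀ i < m, f i = q i) (P : ℕ → Prop) [DecidablePred P] :
      ∑ i ∈ range m with P i, f i = ∑ i ∈ range m with P i, q i :=
    sum_congr rfl fun i hi => hf i (mem_range.1 (mem_filter.1 hi).1)
  have hc : ∀ i < m, c i = q i := fun i hi => by simp [c, hi]
  have hlast : ¬ m + 2 + 1 < m ∧ m + 2 + 1 ≠ m := by omega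
  have hpar := (parity_conditions_iff m c).2
    ⟨by rw [sum_congr_lt c hc]; simp [c], by rw [sum_congr_lt c hc]; simp [c]⟩
  have hend := (endpoint_conditions_iff (m + 2) c hpar.1 hpar.2).2 ⟨by simp [c], by simp [c, hlast]⟩
  refine ⟨_, ⟨c, rfl, fun i hi => hc i (by omega), hpar.1, hpar.2, hend⟩, ?_⟩
  rintro _ ⟨f, rfl, hq, he, ho, hl⟩
  have hf : ∀ i < m, f i = q i := fun i hi => hq i (by omega)
  obtain ⟨f0, f1⟩ := (parity_conditions_iff m f).1 ⟨he, ho⟩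
  obtain ⟨f2, f3⟩ := (endpoint_conditions_iff (m + 2) f he ho).1 hl
  rw [sum_congr_lt f hf] at f0 f1
  refine sum_congr rfl fun i hi => ?_
  have hi' := mem_range.1 hi
  suffices f i = c i by rw [this]
  obtain h | rfl | rfl | rfl | rfl : i < m ∨ i = m ∨ i = m + 1 ∨ i = m + 2 ∨ i = m + 2 + 1 := by
    omega
  · rw [hf i h, hc i h]
  · simp [c, f0]
  · simp [c, f1]
  · simp [c, f2]
  · simp [c, f3, hlast]
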